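/- arXiv:2106.08645 — 5 statements merged into one kernel-verified Lean document; each statement's English description precedes it below -/
import Mathlib

section
/- Let λ ∈ ℂ with λ ≠ −1/(βη²γ²). Then λ is an eigenvalue of the restriction of Â(ξ) to E(ξ) (i.e. there exists a nonzero (e, b) ∈ E(ξ) with Â(ξ)(e, b) = λ (e, b)) if and only if βη²γ²λ² + λ + βη²|ξ|² = 0; moreover, every eigenvector (e, b) ∈ E(ξ) associated with such a λ satisfies ξ · e = 0. -/
noncomputable section

open Complex

/-- ℂ³ with the Hermitian (Euclidean) norm. -/
abbrev V3 : Type := EuclideanSpace ℂ (Fin 3)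
/-- ℝ³ with the Euclidean norm. -/
abbrev R3 : Type := EuclideanSpace ℝ (Fin 3)

/-- The cross product, extended ℂ-bilinearly to ℂ³. -/
def cross (a b : V3) : V3 :=
  (WithLp.equiv 2 (Fin 3 → ℂ)).symm
    ![a 1 * b 2 - a 2 * b 1, a 2 * b 0 - a 0 * b 2, a 0 * b 1 - a 1 * b 0]

/-- The dot product, extended ℂ-bilinearly to ℂ³. -/
def dotc (a b : V3) : ℂ := a 0 * b 0 + a 1 * b 1 + a 2 * b 2

/-- The coercion of a real vector to a complex vector. -/
def toC (ξ : R3) : V3 := (WithLp.equiv 2 (Fin 3 → ℂ)).symm fun j => ((ξ j : ℝ) : ℂ)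

/-- The Fourier-side Maxwell operator Â(ξ). -/
def Ahat (β η γ : ℝ) (ξ : R3) (v : V3 × V3) : V3 × V3 :=
  (-(1 / ((β : ℂ) * (η : ℂ) ^ 2 * (γ : ℂ) ^ 2)) • v.1 + (I / (γ : ℂ)) • cross (toC ξ) v.2,
   (-(I / (γ : ℂ))) • cross (toC ξ) v.1)

/-- The eigenvalue λ₀ = −1/(βη²γ²). -/
def lam0 (β η γ : ℝ) : ℂ := -(1 / ((β : ℂ) * (η : ℂ) ^ 2 * (γ : ℂ) ^ 2))

lemma dotc_smul_right (a b : V3) (k : ℂ) : dotc a (k • b) = k * dotc a b := by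
  simp only [dotc, PiLp.smul_apply, smul_eq_mul]
  ring

lemma dotc_cross_self (a b : V3) : dotc a (cross a b) = 0 := by
  simp [dotc, cross]
  ring

lemma cross_smul_right (a b : V3) (k : ℂ) : cross a (k • b) = k • cross a b := by
  ext i
  fin_cases i <;> simp [cross] <;> ring

lemma cross_zero_right (a : V3) : cross a 0 = 0 := by
  simpa using cross_smul_right a 0 0

lemma cross_cross_self (a b : V3) :
    cross a (cross a b) = dotc a b • a - dotc a a • b := by
  ext i
  fin_cases i <;> simp [cross, dotc] <;> ring

lemma dotc_toC_self (ξ : R3) : dotc (toC ξ) (toC ξ) = (‖ξ‖ : ℂ) ^ 2 := by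
  rw [← ofReal_pow, EuclideanSpace.norm_sq_eq]
  simp [dotc, toC, Fin.sum_univ_three]
  ring

lemma dotc_toC_self_ne_zero {ξ : R3} (hξ : ξ ≠ 0) : dotc (toC ξ) (toC ξ) ≠ 0 := by
  simpa [dotc_toC_self] using hξ

lemma exists_cross_ne_zero {a : V3} (ha : a ≠ 0) : ∃ w, cross a w ≠ 0 := by
  by_contra! h
  refine ha ?_
  have h0 := h (EuclideanSpace.single 0 1)
  have h1 := h (EuclideanSpace.single 1 1)
  have e1 := congrArg (fun v : V3 => v 1) h0
  have e2 := congrArg (fun v : V3 => v 2) h0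
  have e0 := congrArg (fun v : V3 => v 2) h1
  simp [cross] at e0 e1 e2
  ext i
  fin_cases i <;> simp [e0, e1, e2]

lemma eq_zero_of_dotc_eq_zero_of_cross_eq_zero {a b : V3} (ha : dotc a a ≠ 0)
    (hd : dotc a b = 0) (hc : cross a b = 0) : b = 0 := by
  have h := cross_cross_self a b
  rw [hc, hd, cross_zero_right, zero_smul, zero_sub, eq_comm, neg_eq_zero] at h
  exact (smul_eq_zero.mp h).resolve_left ha

lemma Ahat_eq_smul_iff (β η γ : ℝ) (ξ : R3) (lam : ℂ) (e b : V3) :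
    Ahat β η γ ξ (e, b) = lam • (e, b) ↔
      (I / (γ : ℂ)) • cross (toC ξ) b = (lam - lam0 β η γ) • e ∧
        (-(I / (γ : ℂ))) • cross (toC ξ) e = lam • b := by
  rw [Ahat, Prod.smul_mk, Prod.mk.injEq, sub_smul, eq_sub_iff_add_eq', lam0]

lemma dotc_eq_zero_of_Ahat_eq_smul {β η γ : ℝ} {ξ : R3} {lam : ℂ} (hlam : lam ≠ lam0 β η γ)
    {e b : V3} (h : Ahat β η γ ξ (e, b) = lam • (e, b)) : dotc (toC ξ) e = 0 := by
  have h1 := congrArg (dotc (toC ξ)) ((Ahat_eq_smul_iff ..).mp h).1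
  rw [dotc_smul_right, dotc_smul_right, dotc_cross_self, mul_zero, eq_comm] at h1
  exact (mul_eq_zero.mp h1).resolve_left (sub_ne_zero.mpr hlam)

lemma characteristic_eq_zero_iff {β η γ : ℝ} (hβ : β ≠ 0) (hη : η ≠ 0) (hγ : γ ≠ 0)
    (lam s : ℂ) :
    (β : ℂ) * (η : ℂ) ^ 2 * (γ : ℂ) ^ 2 * lam ^ 2 + lam + (β : ℂ) * (η : ℂ) ^ 2 * s = 0 ↔
      lam * (lam - lam0 β η γ) = (I / (γ : ℂ)) ^ 2 * s := by
  have hβ' : (β : ℂ) ≠ 0 := ofReal_ne_zero.mpr hβ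
  have hη' : (η : ℂ) ≠ 0 := ofReal_ne_zero.mpr hη
  have hγ' : (γ : ℂ) ≠ 0 := ofReal_ne_zero.mpr hγ
  have key : (β : ℂ) * (η : ℂ) ^ 2 * (γ : ℂ) ^ 2 * lam ^ 2 + lam + (β : ℂ) * (η : ℂ) ^ 2 * s =
      (β : ℂ) * (η : ℂ) ^ 2 * (γ : ℂ) ^ 2 *
        (lam * (lam - lam0 β η γ) - (I / (γ : ℂ)) ^ 2 * s) := by
    rw [lam0, div_pow, I_sq]
    field_simp
    ring
  rw [key, mul_eq_zero, sub_eq_zero, or_iff_right (by positivity)]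

/-- for λ ≠ −1/(βη²γ²), λ is an eigenvalue of the restriction of Â(ξ) to E(ξ)
iff βη²γ²λ² + λ + βη²|ξ|² = 0, and every associated eigenvector (e,b) ∈ E(ξ) has ξ·e = 0. -/
theorem eigenvalue_nonzero_characterization (β η γ : ℝ) (hβ : 0 < β) (hη : 0 < η) (hγ : 0 < γ)
    (ξ : R3) (hξ : ξ ≠ 0) (lam : ℂ) (hlam : lam ≠ lam0 β η γ) :
    ((∃ v : V3 × V3, dotc (toC ξ) v.2 = 0 ∧ v ≠ 0 ∧ Ahat β η γ ξ v = lam • v) ↔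
      (β : ℂ) * (η : ℂ) ^ 2 * (γ : ℂ) ^ 2 * lam ^ 2 + lam
        + (β : ℂ) * (η : ℂ) ^ 2 * (‖ξ‖ : ℂ) ^ 2 = 0) ∧
    (∀ e b : V3, dotc (toC ξ) b = 0 → (e, b) ≠ 0 →
      Ahat β η γ ξ (e, b) = lam • (e, b) → dotc (toC ξ) e = 0) := by
  have ha := dotc_toC_self_ne_zero hξ
  refine ⟨?_, fun e b _ _ h => dotc_eq_zero_of_Ahat_eq_smul hlam h⟩
  rw [characteristic_eq_zero_iff hβ.ne' hη.ne' hγ.ne', ← dotc_toC_self]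
  have hc : I / (γ : ℂ) ≠ 0 := div_ne_zero I_ne_zero (ofReal_ne_zero.mpr hγ.ne')
  constructor
  · rintro ⟨⟨e, b⟩, hb, hv, h⟩
    have he := dotc_eq_zero_of_Ahat_eq_smul hlam h
    obtain ⟨h1, h2⟩ := (Ahat_eq_smul_iff ..).mp h
    have he0 : e ≠ 0 := by
      rintro rfl
      rw [smul_zero, smul_eq_zero_iff_right hc] at h1
      exact hv (Prod.ext rfl (eq_zero_of_dotc_eq_zero_of_cross_eq_zero ha hb h1))
    refine smul_left_injective ℂ he0 ?_
    calc (lam * (lam - lam0 β η γ)) • e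
        = (I / (γ : ℂ)) • cross (toC ξ) (lam • b) := by
          rw [mul_smul, ← h1, cross_smul_right, smul_comm]
      _ = ((I / (γ : ℂ)) ^ 2 * dotc (toC ξ) (toC ξ)) • e := by
          rw [← h2, cross_smul_right, cross_cross_self, he]
          module
  · intro h
    have hlam0 : lam ≠ 0 := by
      rintro rfl
      rw [zero_mul] at h
      exact mul_ne_zero (pow_ne_zero 2 hc) ha h.symm
    obtain ⟨w, hw⟩ := exists_cross_ne_zero (a := toC ξ) (by
      intro h0
      simp [h0, dotc] at ha)
    refine ⟨(lam • cross (toC ξ) w, (-(I / (γ : ℂ))) • cross (toC ξ) (cross (toC ξ) w)),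
      ?_, ?_, ?_⟩
    · rw [dotc_smul_right, dotc_cross_self, mul_zero]
    · exact fun h0 => smul_ne_zero hlam0 hw (congrArg Prod.fst h0)
    · refine (Ahat_eq_smul_iff ..).mpr ⟨?_, ?_⟩
      · rw [cross_smul_right, cross_cross_self _ (cross (toC ξ) w), dotc_cross_self, smul_smul _ lam,
          mul_comm _ lam, h]
        module
      · rw [cross_smul_right, smul_comm]
end
end

section
/- For every (e, b) ∈ ℂ³ × ℂ³, the real part of the Hermitian inner product of Â(ξ)(e, b) with (e, b) equals −|e|²/(βη²γ²); in particular Re⟨Â(ξ)v, v⟩ ≤ 0 for all v ∈ ℂ³ × ℂ³, i.e. Â(ξ) is dissipative. -/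
noncomputable section

open Complex

/-- The standard Hermitian inner product on ℂ³, ⟨a, b⟩ = Σⱼ aⱼ conj(bⱼ). -/
def hinner (a b : V3) : ℂ :=
  a 0 * (starRingEnd ℂ) (b 0) + a 1 * (starRingEnd ℂ) (b 1) + a 2 * (starRingEnd ℂ) (b 2)

@[simp]
lemma cross_toLp_apply (a b : V3) (j : Fin 3) : cross a b j =
    ![a 1 * b 2 - a 2 * b 1, a 2 * b 0 - a 0 * b 2, a 0 * b 1 - a 1 * b 0] j := rfl

@[simp]
lemma toC_apply (ξ : R3) (j : Fin 3) : toC ξ j = (ξ j : ℂ) := rfl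

lemma hinner_add_left (a b c : V3) : hinner (a + b) c = hinner a c + hinner b c := by
  simp only [hinner, PiLp.add_apply]
  ring

lemma hinner_smul_left (z : ℂ) (a b : V3) : hinner (z • a) b = z * hinner a b := by
  simp only [hinner, PiLp.smul_apply, smul_eq_mul]
  ring

lemma hinner_self (a : V3) : hinner a a = ((‖a‖ ^ 2 : ℝ) : ℂ) := by
  simp [hinner, EuclideanSpace.norm_sq_eq, Fin.sum_univ_three, mul_conj, normSq_eq_norm_sq]

/-- Crossing with a real vector is skew-Hermitian. -/
lemma hinner_cross_toC (ξ : R3) (a b : V3) :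
    hinner (cross (toC ξ) a) b = -(starRingEnd ℂ) (hinner (cross (toC ξ) b) a) := by
  simp [hinner]
  ring

lemma re_hinner_Ahat (β η γ : ℝ) (ξ : R3) (v : V3 × V3) :
    (hinner (Ahat β η γ ξ v).1 v.1 + hinner (Ahat β η γ ξ v).2 v.2).re
      = -‖v.1‖ ^ 2 / (β * η ^ 2 * γ ^ 2) := by
  have hcoef : -(1 / ((β : ℂ) * (η : ℂ) ^ 2 * (γ : ℂ) ^ 2))
      = ((-(1 / (β * η ^ 2 * γ ^ 2)) : ℝ) : ℂ) := by
    push_cast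
    rfl
  have hI : I / (γ : ℂ) = ((γ⁻¹ : ℝ) : ℂ) * I := by
    push_cast
    ring
  simp only [Ahat, hinner_add_left, hinner_smul_left, hinner_self]
  rw [hcoef, hI, hinner_cross_toC ξ v.2 v.1, ← ofReal_mul]
  simp only [add_re, ofReal_re, neg_re, mul_re, neg_im, mul_im, ofReal_im, I_re, I_im,
    conj_re, conj_im]
  ring

/-- Re⟨Â(ξ)(e,b), (e,b)⟩ = −|e|²/(βη²γ²); in particular Â(ξ) is dissipative. -/
theorem Ahat_dissipative (β η γ : ℝ) (hβ : 0 < β) (hη : 0 < η) (hγ : 0 < γ)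
    (ξ : R3) (hξ : ξ ≠ 0) :
    (∀ v : V3 × V3,
      (hinner (Ahat β η γ ξ v).1 v.1 + hinner (Ahat β η γ ξ v).2 v.2).re
        = -‖v.1‖ ^ 2 / (β * η ^ 2 * γ ^ 2)) ∧
    ∀ v : V3 × V3,
      (hinner (Ahat β η γ ξ v).1 v.1 + hinner (Ahat β η γ ξ v).2 v.2).re ≤ 0 := by
  refine ⟨re_hinner_Ahat β η γ ξ, fun v => ?_⟩
  rw [re_hinner_Ahat]
  exact div_nonpos_of_nonpos_of_nonneg (neg_nonpos.mpr (sq_nonneg _)) (by positivity)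
end
end

section
/- For every real λ > 0 and every v ∈ ℂ³ × ℂ³, one has ‖λ v − Â(ξ) v‖ ≥ λ ‖v‖; in particular the map λ·Id − Â(ξ) is bijective on ℂ³ × ℂ³ and its inverse has operator norm at most 1/λ. -/
noncomputable section

open Complex

/-- The norm on ℂ³ × ℂ³ induced by the standard Hermitian inner product. -/
def normP (v : V3 × V3) : ℝ := Real.sqrt (‖v.1‖ ^ 2 + ‖v.2‖ ^ 2)

theorem normP_sq (v : V3 × V3) : normP v ^ 2 = ‖v.1‖ ^ 2 + ‖v.2‖ ^ 2 :=
  Real.sq_sqrt (by positivity)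

theorem normP_nonneg (v : V3 × V3) : 0 ≤ normP v := Real.sqrt_nonneg _

theorem eq_zero_of_normP_eq_zero {v : V3 × V3} (h : normP v = 0) : v = 0 := by
  have hv := normP_sq v
  rw [h] at hv
  have h₁ : ‖v.1‖ = 0 := by nlinarith [sq_nonneg ‖v.1‖, sq_nonneg ‖v.2‖]
  have h₂ : ‖v.2‖ = 0 := by nlinarith [sq_nonneg ‖v.1‖, sq_nonneg ‖v.2‖]
  exact Prod.ext (norm_eq_zero.mp h₁) (norm_eq_zero.mp h₂)

/-- The curl part of the Maxwell operator is skew-Hermitian. -/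
theorem re_inner_curl (k : ℝ) (ξ : R3) (e b : V3) :
    (inner ℂ e ((I * (k : ℂ)) • cross (toC ξ) b)).re
      + (inner ℂ b ((-(I * (k : ℂ))) • cross (toC ξ) e)).re = 0 := by
  simp [PiLp.inner_apply, Fin.sum_univ_three, cross, toC]
  ring

/-- The operator `Ahat` is dissipative. -/
theorem re_inner_Ahat (β η γ : ℝ) (ξ : R3) (v : V3 × V3) :
    (inner ℂ v.1 (Ahat β η γ ξ v).1).re + (inner ℂ v.2 (Ahat β η γ ξ v).2).re
      = -(1 / (β * η ^ 2 * γ ^ 2)) * ‖v.1‖ ^ 2 := by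
  have h := re_inner_curl γ⁻¹ ξ v.1 v.2
  have hc : (inner ℂ v.1 (-(1 / ((β : ℂ) * (η : ℂ) ^ 2 * (γ : ℂ) ^ 2)) • v.1)).re
      = -(1 / (β * η ^ 2 * γ ^ 2)) * ‖v.1‖ ^ 2 := by
    rw [inner_smul_right, inner_self_eq_norm_sq_to_K]
    norm_cast
    rw [re_ofReal_mul]
    rfl
  push_cast at h
  simp only [Ahat, inner_add_right, add_re, hc, div_eq_mul_inv I]
  linarith

theorem norm_ofReal_smul_sub_sq (r : ℝ) (x w : V3) :
    ‖(r : ℂ) • x - w‖ ^ 2 = r ^ 2 * ‖x‖ ^ 2 - 2 * r * (inner ℂ x w).re + ‖w‖ ^ 2 := by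
  rw [@norm_sub_sq ℂ, inner_smul_left, norm_smul, conj_ofReal, norm_real, mul_pow,
    Real.norm_eq_abs, sq_abs]
  simp only [RCLike.re_to_complex, re_ofReal_mul]
  ring

theorem mul_normP_le_normP_smul_sub_Ahat {β η γ : ℝ} (hβ : 0 < β) (hη : 0 < η) (hγ : 0 < γ)
    (ξ : R3) {r : ℝ} (hr : 0 < r) (v : V3 × V3) :
    r * normP v ≤ normP ((r : ℂ) • v - Ahat β η γ ξ v) := by
  refine le_of_sq_le_sq ?_ (normP_nonneg _)
  have hA := re_inner_Ahat β η γ ξ v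
  have hnonneg : 0 ≤ r * (1 / (β * η ^ 2 * γ ^ 2) * ‖v.1‖ ^ 2) := by positivity
  rw [mul_pow, normP_sq, normP_sq, Prod.fst_sub, Prod.snd_sub, Prod.smul_fst, Prod.smul_snd,
    norm_ofReal_smul_sub_sq, norm_ofReal_smul_sub_sq]
  have hrA := congrArg (fun t => r * t) hA
  simp only [mul_add] at hrA
  nlinarith [sq_nonneg ‖(Ahat β η γ ξ v).1‖, sq_nonneg ‖(Ahat β η γ ξ v).2‖]

theorem cross_add (a b c : V3) : cross a (b + c) = cross a b + cross a c := by
  ext i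
  fin_cases i <;> simp [cross] <;> ring

theorem cross_smul (z : ℂ) (a b : V3) : cross a (z • b) = z • cross a b := by
  ext i
  fin_cases i <;> simp [cross] <;> ring

/-- `Ahat` as a linear map. -/
def AhatLinear (β η γ : ℝ) (ξ : R3) : V3 × V3 →ₗ[ℂ] V3 × V3 where
  toFun := Ahat β η γ ξ
  map_add' v w := by
    ext1 <;> simp only [Ahat, Prod.fst_add, Prod.snd_add, cross_add] <;> module
  map_smul' z v := by
    ext1 <;> simp only [Ahat, Prod.smul_fst, Prod.smul_snd, cross_smul, RingHom.id_apply] <;>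
      module

/-- for real λ > 0, ‖λv − Â(ξ)v‖ ≥ λ‖v‖ for all v; in particular λ·Id − Â(ξ) is
bijective on ℂ³ × ℂ³ and its inverse has operator norm at most 1/λ. -/
theorem resolvent_estimate (β η γ : ℝ) (hβ : 0 < β) (hη : 0 < η) (hγ : 0 < γ)
    (ξ : R3) (hξ : ξ ≠ 0) (lam : ℝ) (hlam : 0 < lam) :
    (∀ v : V3 × V3,
      normP ((lam : ℂ) • v - Ahat β η γ ξ v) ≥ lam * normP v) ∧
    Function.Bijective (fun v : V3 × V3 => (lam : ℂ) • v - Ahat β η γ ξ v) ∧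
    ∀ v : V3 × V3, normP v ≤ (1 / lam) * normP ((lam : ℂ) • v - Ahat β η γ ξ v) := by
  have hbound := mul_normP_le_normP_smul_sub_Ahat hβ hη hγ ξ hlam
  refine ⟨hbound, ?_, fun v => ?_⟩
  · let T : V3 × V3 →ₗ[ℂ] V3 × V3 := (lam : ℂ) • LinearMap.id - AhatLinear β η γ ξ
    have hinj : Function.Injective T := by
      refine (injective_iff_map_eq_zero T).mpr fun v hv => eq_zero_of_normP_eq_zero ?_
      have h : lam * normP v ≤ normP (T v) := hbound v
      have h₀ : normP (0 : V3 × V3) = 0 := by simp [normP]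
      rw [hv, h₀] at h
      exact le_antisymm (nonpos_of_mul_nonpos_right h hlam) (normP_nonneg v)
    exact ⟨hinj, LinearMap.injective_iff_surjective.mp hinj⟩
  · rw [one_div, ← div_eq_inv_mul, le_div_iff₀' hlam]
    exact hbound v
end
end

section
/- If |ξ| ≤ 1/(2βη²γ), then λ₊(ξ) is real and satisfies −2βη²|ξ|² ≤ λ₊(ξ) ≤ −βη²|ξ|². -/
noncomputable section

open Complex

/-- δ(ξ) = √(1 − 4β²η⁴γ²|ξ|²) if |ξ| ≤ 1/(2βη²γ), and i√(4β²η⁴γ²|ξ|² − 1) otherwise. -/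
def deltaF (β η γ : ℝ) (ξ : R3) : ℂ :=
  if ‖ξ‖ ≤ 1 / (2 * β * η ^ 2 * γ) then
    ((Real.sqrt (1 - 4 * β ^ 2 * η ^ 4 * γ ^ 2 * ‖ξ‖ ^ 2) : ℝ) : ℂ)
  else I * ((Real.sqrt (4 * β ^ 2 * η ^ 4 * γ ^ 2 * ‖ξ‖ ^ 2 - 1) : ℝ) : ℂ)

/-- λ₊(ξ) = (−1 + δ(ξ))/(2βη²γ²). -/
def lamP (β η γ : ℝ) (ξ : R3) : ℂ :=
  (-1 + deltaF β η γ ξ) / (2 * (β : ℂ) * (η : ℂ) ^ 2 * (γ : ℂ) ^ 2)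

/-- λ₋(ξ) = (−1 − δ(ξ))/(2βη²γ²). -/
def lamM (β η γ : ℝ) (ξ : R3) : ℂ :=
  (-1 - deltaF β η γ ξ) / (2 * (β : ℂ) * (η : ℂ) ^ 2 * (γ : ℂ) ^ 2)

theorem lamP_eq_ofReal_of_norm_le {β η γ : ℝ} {ξ : R3} (h : ‖ξ‖ ≤ 1 / (2 * β * η ^ 2 * γ)) :
    lamP β η γ ξ =
      (((-1 + Real.sqrt (1 - 4 * β ^ 2 * η ^ 4 * γ ^ 2 * ‖ξ‖ ^ 2)) /
        (2 * β * η ^ 2 * γ ^ 2) : ℝ) : ℂ) := by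
  rw [lamP, deltaF, if_pos h]
  push_cast
  rfl

/-- if |ξ| ≤ 1/(2βη²γ), then λ₊(ξ) is real and
−2βη²|ξ|² ≤ λ₊(ξ) ≤ −βη²|ξ|². -/
theorem lamP_bounds_low_freq (β η γ : ℝ) (hβ : 0 < β) (hη : 0 < η) (hγ : 0 < γ)
    (ξ : R3) (hξ : ξ ≠ 0) (h : ‖ξ‖ ≤ 1 / (2 * β * η ^ 2 * γ)) :
    (lamP β η γ ξ).im = 0 ∧
    -(2 * β * η ^ 2 * ‖ξ‖ ^ 2) ≤ (lamP β η γ ξ).re ∧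
    (lamP β η γ ξ).re ≤ -(β * η ^ 2 * ‖ξ‖ ^ 2) := by
  have hx : 4 * β ^ 2 * η ^ 4 * γ ^ 2 * ‖ξ‖ ^ 2 ≤ 1 := by
    have h1 : ‖ξ‖ * (2 * β * η ^ 2 * γ) ≤ 1 := (le_div_iff₀ (by positivity)).1 h
    calc 4 * β ^ 2 * η ^ 4 * γ ^ 2 * ‖ξ‖ ^ 2 = (‖ξ‖ * (2 * β * η ^ 2 * γ)) ^ 2 := by ring
      _ ≤ 1 := pow_le_one₀ (by positivity) h1
  have hx0 : 0 ≤ 4 * β ^ 2 * η ^ 4 * γ ^ 2 * ‖ξ‖ ^ 2 := by positivity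
  have hD : 0 < 2 * β * η ^ 2 * γ ^ 2 := by positivity
  rw [lamP_eq_ofReal_of_norm_le h, ofReal_im, ofReal_re, le_div_iff₀ hD, div_le_iff₀ hD]
  refine ⟨rfl, ?_, ?_⟩
  · have hs := Real.le_sqrt_of_sq_le
      (show (1 - 4 * β ^ 2 * η ^ 4 * γ ^ 2 * ‖ξ‖ ^ 2) ^ 2 ≤
        1 - 4 * β ^ 2 * η ^ 4 * γ ^ 2 * ‖ξ‖ ^ 2 from
        pow_le_of_le_one (by linarith) (by linarith) two_ne_zero)
    linarith
  · have hs : Real.sqrt (1 - 4 * β ^ 2 * η ^ 4 * γ ^ 2 * ‖ξ‖ ^ 2) ≤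
        1 - 4 * β ^ 2 * η ^ 4 * γ ^ 2 * ‖ξ‖ ^ 2 / 2 :=
      Real.sqrt_le_iff.2 ⟨by linarith,
        by linarith [sq_nonneg (4 * β ^ 2 * η ^ 4 * γ ^ 2 * ‖ξ‖ ^ 2)]⟩
    linarith
end
end

section
/- For any E, B ∈ ℂ³ one has |E + (i/(γ λ₋(ξ))) ξ × B| ≤ |E| + |B| and |B + (i/(γ λ₋(ξ))) ξ × E| ≤ |E| + |B|, where | · | is the Hermitian norm on ℂ³. -/
noncomputable section

open Complex

/-- The cross product with a real vector obeys `|ξ × B| ≤ |ξ| |B|`. -/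
theorem norm_cross_toC_le (ξ : R3) (B : V3) : ‖cross (toC ξ) B‖ ≤ ‖ξ‖ * ‖B‖ := by
  refine le_of_pow_le_pow_left₀ two_ne_zero (by positivity) ?_
  rw [mul_pow, EuclideanSpace.norm_sq_eq, EuclideanSpace.norm_sq_eq, EuclideanSpace.norm_sq_eq]
  simp only [Fin.sum_univ_three, cross, toC, WithLp.equiv_symm_apply, Matrix.cons_val,
    Real.norm_eq_abs, sq_abs, Complex.sq_norm, Complex.normSq_apply, sub_re, sub_im, mul_re, mul_im,
    ofReal_re, ofReal_im]
  nlinarith [sq_nonneg (ξ 0 * (B 0).re + ξ 1 * (B 1).re + ξ 2 * (B 2).re),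
    sq_nonneg (ξ 0 * (B 0).im + ξ 1 * (B 1).im + ξ 2 * (B 2).im)]

/-- `2βη²γ|ξ| ≤ |1 + δ(ξ)|`. -/
theorem le_norm_one_add_deltaF (β η γ : ℝ) (hβ : 0 < β) (hη : 0 < η) (hγ : 0 < γ) (ξ : R3) :
    2 * β * η ^ 2 * γ * ‖ξ‖ ≤ ‖1 + deltaF β η γ ξ‖ := by
  have hc : 0 < 2 * β * η ^ 2 * γ := by positivity
  unfold deltaF
  split_ifs with h
  · rw [le_div_iff₀' hc] at h
    refine h.trans (le_trans ?_ (re_le_norm _))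
    simp [Real.sqrt_nonneg]
  · rw [not_le, div_lt_iff₀' hc] at h
    have hs : 0 ≤ 4 * β ^ 2 * η ^ 4 * γ ^ 2 * ‖ξ‖ ^ 2 - 1 := by nlinarith
    refine le_of_pow_le_pow_left₀ two_ne_zero (norm_nonneg _) (le_of_eq ?_)
    rw [Complex.sq_norm, Complex.normSq_apply]
    simp only [add_re, one_re, mul_re, I_re, ofReal_re, I_im, ofReal_im, add_im, one_im, mul_im]
    linear_combination -Real.sq_sqrt hs

/-- The coupling factor satisfies `|i/(γλ₋(ξ))| |ξ| ≤ 1`. -/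
theorem norm_I_div_lamM_mul_norm_le_one (β η γ : ℝ) (hβ : 0 < β) (hη : 0 < η) (hγ : 0 < γ)
    (ξ : R3) : ‖I / ((γ : ℂ) * lamM β η γ ξ)‖ * ‖ξ‖ ≤ 1 := by
  have hfactor : ‖(γ : ℂ) * lamM β η γ ξ‖ = ‖1 + deltaF β η γ ξ‖ / (2 * β * η ^ 2 * γ) := by
    rw [lamM, show -1 - deltaF β η γ ξ = -(1 + deltaF β η γ ξ) by ring]
    simp only [norm_mul, norm_div, norm_neg, norm_pow, norm_real, Real.norm_eq_abs, abs_of_pos hβ,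
      abs_of_pos hη, abs_of_pos hγ, Complex.norm_ofNat]
    field_simp
  rw [norm_div, norm_I, hfactor, one_div_mul_eq_div]
  refine div_le_one_of_le₀ ?_ (by positivity)
  rw [le_div_iff₀' (by positivity)]
  exact le_norm_one_add_deltaF β η γ hβ hη hγ ξ

/-- `|(i/(γλ₋(ξ))) ξ × B| ≤ |B|`. -/
theorem norm_smul_cross_le (β η γ : ℝ) (hβ : 0 < β) (hη : 0 < η) (hγ : 0 < γ) (ξ : R3) (B : V3) :
    ‖(I / ((γ : ℂ) * lamM β η γ ξ)) • cross (toC ξ) B‖ ≤ ‖B‖ := by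
  rw [norm_smul]
  calc _ ≤ ‖I / ((γ : ℂ) * lamM β η γ ξ)‖ * (‖ξ‖ * ‖B‖) := by
        gcongr
        exact norm_cross_toC_le ξ B
    _ = ‖I / ((γ : ℂ) * lamM β η γ ξ)‖ * ‖ξ‖ * ‖B‖ := by ring
    _ ≤ ‖B‖ := mul_le_of_le_one_left (norm_nonneg _)
        (norm_I_div_lamM_mul_norm_le_one β η γ hβ hη hγ ξ)

/-- for any E, B ∈ ℂ³, |E + (i/(γλ₋(ξ))) ξ × B| ≤ |E| + |B| and
|B + (i/(γλ₋(ξ))) ξ × E| ≤ |E| + |B|. -/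
theorem component_bounds (β η γ : ℝ) (hβ : 0 < β) (hη : 0 < η) (hγ : 0 < γ)
    (ξ : R3) (hξ : ξ ≠ 0) (E B : V3) :
    ‖E + (I / ((γ : ℂ) * lamM β η γ ξ)) • cross (toC ξ) B‖ ≤ ‖E‖ + ‖B‖ ∧
    ‖B + (I / ((γ : ℂ) * lamM β η γ ξ)) • cross (toC ξ) E‖ ≤ ‖E‖ + ‖B‖ := by
  have key := norm_smul_cross_le β η γ hβ hη hγ ξ
  refine ⟨(norm_add_le _ _).trans ?_, (norm_add_le _ _).trans ?_⟩
  · gcongr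
    exact key B
  · rw [add_comm ‖E‖]
    gcongr
    exact key E
end
end
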